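/- arXiv:2008.12998 — 2 statements merged into one kernel-verified Lean document; each statement's English description precedes it below -/
import Mathlib

section
/- Let D ⊆ F_{q^m}^* be an F_q^*-invariant partial difference set with parameters (q^m, k, λ, μ), and let θ1 > 0 > θ2 be real numbers such that Ψ_a(D) ∈ {θ1, θ2} for every a ∈ F_{q^m}^* (the restricted eigenvalues of Cay(F_{q^m}, D)); set θ0 = max(|θ1|, |θ2|). If (1) k − θ2 ≠ q^m, (2) k > θ1 and k > −(q−1)θ2, and at least one of the following holds: (3a) k < q^m + qθ2 − (q−1)θ1, (3b) k > max(qθ0 + θ1, qθ0 − (q−1)θ2), (3c) q^{m−1} + θ2 − θ1 > θ0, then C(M_D) is a minimal linear code. -/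
/-- The canonical additive character of a finite field `K` of characteristic
`p`:  `Ψ(x) = exp(2πi·Tr_{K/F_p}(x)/p)`. -/
noncomputable def canonAddChar (p : ℕ) (K : Type*) [Field K] [CharP K p] (x : K) : ℂ :=
  letI := ZMod.algebra K p
  Complex.exp (2 * Real.pi * Complex.I * ((Algebra.trace (ZMod p) K x).val : ℂ) / p)

/-- The codeword `c(u,v)` of the code `C(M_D)`. -/
noncomputable def codewordMD (F E : Type*) [Field F] [Field E] [DecidableEq E] [Algebra F E]
    (D : Finset E) (w : F × E) : {x : E // x ≠ 0} → F :=
  fun x => w.1 * (if (x : E) ∈ D then (1 : F) else 0) + Algebra.trace F E (w.2 * (x : E))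

open Finset in
theorem card_mul_card_filter_eq_zero {G H : Type*} [AddGroup G] [AddGroup H] [Fintype G]
    [Fintype H] [DecidableEq H] (f : G →+ H) (hf : Function.Surjective f) :
    Fintype.card H * #{x | f x = 0} = Fintype.card G := by
  have h := f.ker.card_mul_index
  rw [AddSubgroup.index_ker, AddMonoidHom.range_eq_top.mpr hf, AddSubgroup.card_top,
    Nat.card_eq_fintype_card (α := H), Nat.card_eq_fintype_card (α := G)] at h
  rw [← h, mul_comm]
  congr 1
  exact (Nat.subtype_card _ fun x ↦ by simp [AddMonoidHom.mem_ker]).symm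

section Trace

variable {F E : Type*} [Field F] [Field E] [Fintype F] [Fintype E] [Algebra F E]

theorem exists_trace_mul_ne_zero {v : E} (hv : v ≠ 0) : ∃ x, Algebra.trace F E (v * x) ≠ 0 := by
  by_contra! h
  exact hv ((traceForm_nondegenerate F E).1 v h)

theorem exists_eq_smul_of_trace_eq_zero {v w : E}
    (h : ∀ x, Algebra.trace F E (v * x) = 0 → Algebra.trace F E (w * x) = 0) :
    ∃ a : F, w = a • v := by
  rcases eq_or_ne v 0 with rfl | hv
  · refine ⟨0, ?_⟩
    by_contra hw
    obtain ⟨x, hx⟩ := exists_trace_mul_ne_zero (F := F) (v := w) (by simpa using hw)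
    exact hx (h x (by simp))
  obtain ⟨x₀, hx₀⟩ := exists_trace_mul_ne_zero (F := F) hv
  set b := Algebra.trace F E (v * x₀) with hb
  set a := Algebra.trace F E (w * x₀) / b with ha
  refine ⟨a, ?_⟩
  by_contra hw
  obtain ⟨x, hx⟩ := exists_trace_mul_ne_zero (F := F) (sub_ne_zero.mpr hw)
  apply hx
  have key := h (x - (Algebra.trace F E (v * x) / b) • x₀) (by
    simp only [mul_sub, mul_smul_comm, map_sub, map_smul, smul_eq_mul, ← hb]
    field_simp
    ring)
  simp only [mul_sub, mul_smul_comm, map_sub, map_smul, smul_eq_mul] at key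
  simp only [sub_mul, smul_mul_assoc, map_sub, map_smul, smul_eq_mul, ha]
  rw [← key]
  ring

variable [DecidableEq F]

open Finset in
theorem card_mul_card_filter_trace_eq_zero {v : E} (hv : v ≠ 0) :
    Fintype.card F * #{x : E | Algebra.trace F E (v * x) = 0} = Fintype.card E := by
  refine card_mul_card_filter_eq_zero
    ((Algebra.trace F E).comp (LinearMap.mulLeft F v)).toAddMonoidHom fun c ↦ ?_
  obtain ⟨x, hx⟩ := exists_trace_mul_ne_zero (F := F) hv
  exact ⟨(c / Algebra.trace F E (v * x)) • x, by simp [hx]⟩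

open Finset in
theorem card_mul_card_filter_trace_eq_zero_and {v w : E} (hv : v ≠ 0)
    (hw : ∀ a : F, w ≠ a • v) :
    Fintype.card F * (Fintype.card F *
      #{x : E | Algebra.trace F E (v * x) = 0 ∧ Algebra.trace F E (w * x) = 0}) =
        Fintype.card E := by
  have hx₀ : ∃ x, Algebra.trace F E (v * x) = 0 ∧ Algebra.trace F E (w * x) ≠ 0 := by
    by_contra! h
    obtain ⟨a, ha⟩ := exists_eq_smul_of_trace_eq_zero h
    exact hw a ha
  obtain ⟨x₀, hvx₀, hwx₀⟩ := hx₀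
  obtain ⟨y, hy⟩ := exists_trace_mul_ne_zero (F := F) hv
  have := card_mul_card_filter_eq_zero
    (((Algebra.trace F E).comp (LinearMap.mulLeft F v)).prod
      ((Algebra.trace F E).comp (LinearMap.mulLeft F w))).toAddMonoidHom fun ⟨c, d⟩ ↦ by
    refine ⟨(c / Algebra.trace F E (v * y)) • y + ((d - c / Algebra.trace F E (v * y) *
      Algebra.trace F E (w * y)) / Algebra.trace F E (w * x₀)) • x₀, ?_⟩
    simp [mul_add, hy, hvx₀, hwx₀]
  rw [← this, Fintype.card_prod, mul_assoc]
  simp [Prod.ext_iff]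

end Trace

theorem canonAddChar_eq_stdAddChar (p : ℕ) [Fact p.Prime] {K : Type*} [Field K] [CharP K p]
    [Algebra (ZMod p) K] (x : K) :
    canonAddChar p K x = ZMod.stdAddChar (Algebra.trace (ZMod p) K x) := by
  have h (z : ZMod p) : ZMod.stdAddChar z =
      Complex.exp (2 * Real.pi * Complex.I * (z.val : ℂ) / p) := by
    conv_lhs => rw [← ZMod.natCast_zmod_val z, ← Int.cast_natCast, ZMod.stdAddChar_coe]
    simp
  rw [h, canonAddChar, Subsingleton.elim (ZMod.algebra K p) ‹Algebra (ZMod p) K›]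

theorem sum_canonAddChar_smul {p : ℕ} [Fact p.Prime] {F E : Type*} [Field F] [Field E]
    [Fintype F] [Fintype E] [Algebra F E] [CharP E p] [DecidableEq F] (y : E) :
    ∑ l : F, canonAddChar p E (l • y) =
      if Algebra.trace F E y = 0 then (Fintype.card F : ℂ) else 0 := by
  have : CharP F p := (algebraMap F E).charP (algebraMap F E).injective p
  let := ZMod.algebra F p
  let := ZMod.algebra E p
  have : IsScalarTower (ZMod p) F E := IsScalarTower.of_algebraMap_eq' (Subsingleton.elim _ _)
  have key (l : F) : canonAddChar p E (l • y) =
      ZMod.stdAddChar (Algebra.trace (ZMod p) F (Algebra.trace F E y * l)) := by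
    rw [canonAddChar_eq_stdAddChar, ← Algebra.trace_trace (S := F), map_smul, smul_eq_mul, mul_comm]
  simp_rw [key]
  split_ifs with h
  · simp [h]
  · let χ : AddChar F ℂ := ZMod.stdAddChar.compAddMonoidHom
      ((Algebra.trace (ZMod p) F).comp
        (LinearMap.mulLeft (ZMod p) (Algebra.trace F E y))).toAddMonoidHom
    refine AddChar.sum_eq_zero_of_ne_one (ψ := χ) fun hχ ↦ ?_
    obtain ⟨l, hl⟩ := exists_trace_mul_ne_zero (F := ZMod p) h
    have h1 : χ l = 1 := by rw [hχ]; simp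
    exact hl (ZMod.injective_stdAddChar (h1.trans (AddChar.map_zero_eq_one _).symm))

open Finset in
/-- The size of a hyperplane section of an `F`-invariant set `D` in terms of a character sum
over `D`. -/
theorem card_mul_card_filter_trace_of_sum_canonAddChar {p : ℕ} [Fact p.Prime] {F E : Type*}
    [Field F] [Field E] [Fintype F] [Fintype E] [Algebra F E] [CharP E p] [DecidableEq F]
    {D : Finset E} (hinv : ∀ l : F, l ≠ 0 → ∀ x ∈ D, algebraMap F E l * x ∈ D) {v : E} {t : ℝ}
    (ht : ∑ x ∈ D, canonAddChar p E (v * x) = (t : ℂ)) :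
    (Fintype.card F : ℝ) * #{x ∈ D | Algebra.trace F E (v * x) = 0} =
      #D + ((Fintype.card F : ℝ) - 1) * t := by
  have hsum (l : F) (hl : l ≠ 0) : ∑ x ∈ D, canonAddChar p E (l • (v * x)) = t := by
    rw [← ht]
    refine sum_bij' (fun x _ ↦ algebraMap F E l * x) (fun x _ ↦ algebraMap F E l⁻¹ * x)
      (fun x hx ↦ hinv l hl x hx) (fun x hx ↦ hinv _ (inv_ne_zero hl) x hx) ?_ ?_ ?_
    · intro x _
      rw [← mul_assoc, ← map_mul, inv_mul_cancel₀ hl, map_one, one_mul]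
    · intro x _
      rw [← mul_assoc, ← map_mul, mul_inv_cancel₀ hl, map_one, one_mul]
    · intro x _
      rw [Algebra.smul_def, mul_left_comm]
  have h0 : canonAddChar p E (0 : E) = 1 := by simp [canonAddChar]
  have h1 : ∑ l : F, ∑ x ∈ D, canonAddChar p E (l • (v * x)) =
      #D + ((Fintype.card F : ℂ) - 1) * t := by
    rw [← add_sum_erase _ _ (mem_univ (0 : F)),
      sum_congr rfl fun l hl ↦ hsum l (ne_of_mem_erase hl)]
    simp [h0, card_erase_of_mem, Nat.cast_sub Fintype.card_pos]
  rw [sum_comm, sum_congr rfl fun x _ ↦ sum_canonAddChar_smul (v * x), ← sum_filter,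
    sum_const, nsmul_eq_mul, mul_comm] at h1
  exact_mod_cast h1

section HyperplaneSections

open Finset

variable {F E : Type*} [Field F] [Field E] [Fintype F] [Fintype E] [Algebra F E]
  [DecidableEq F] [DecidableEq E] {D : Finset E}

/-- If on the hyperplane `v^⊥` the function `u • f_D + Tr(w ·)` vanishes, with `u ≠ 0`, then either
`D` misses the hyperplane, or the field has two elements and the hyperplane sections of `D` are
determined. -/
theorem filter_eq_empty_or_card_eq_two_of_trace_eq_zero_imp
    (hinv : ∀ l : F, l ≠ 0 → ∀ x ∈ D, algebraMap F E l * x ∈ D) {u : F} (hu : u ≠ 0)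
    {v w : E} (hv : v ≠ 0)
    (h : ∀ x, Algebra.trace F E (v * x) = 0 →
      u * (if x ∈ D then (1 : F) else 0) + Algebra.trace F E (w * x) = 0) :
    #{x ∈ D | Algebra.trace F E (v * x) = 0} = 0 ∨
      Fintype.card F = 2 ∧ w ≠ 0 ∧ v + w ≠ 0 ∧
      4 * #{x ∈ D | Algebra.trace F E (v * x) = 0} = Fintype.card E ∧
      #{x ∈ D | Algebra.trace F E (v * x) = 0} + #{x ∈ D | Algebra.trace F E (w * x) = 0} +
        #{x ∈ D | Algebra.trace F E ((v + w) * x) = 0} = #D := by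
  rcases (#{x ∈ D | Algebra.trace F E (v * x) = 0}).eq_zero_or_pos with h0 | hpos
  · exact .inl h0
  right
  have hmem {x : E} (hx : x ∈ D) (hvx : Algebra.trace F E (v * x) = 0) :
      Algebra.trace F E (w * x) = -u := by
    have := h x hvx
    rw [if_pos hx] at this
    linear_combination this
  obtain ⟨x₀, hx₀⟩ := card_pos.mp hpos
  obtain ⟨hx₀D, hvx₀⟩ := mem_filter.mp hx₀
  have hone (l : F) (hl : l ≠ 0) : l = 1 := by
    have h1 := hmem (hinv l hl x₀ hx₀D) (by
      rw [← Algebra.smul_def, mul_smul_comm, map_smul, hvx₀, smul_zero])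
    rw [← Algebra.smul_def, mul_smul_comm, map_smul, hmem hx₀D hvx₀, smul_eq_mul] at h1
    exact mul_right_cancel₀ (neg_ne_zero.mpr hu) (by rw [h1, one_mul])
  have hF : Fintype.card F = 2 := by
    have : (univ : Finset F) = {0, 1} := by
      ext l
      simpa using or_iff_not_imp_left.mpr (hone l)
    rw [← card_univ, this, card_pair zero_ne_one]
  have hw : ∀ a : F, w ≠ a • v := by
    rintro a rfl
    have := hmem hx₀D hvx₀
    rw [smul_mul_assoc, map_smul, hvx₀, smul_zero] at this
    exact neg_ne_zero.mpr hu this.symm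
  refine ⟨hF, fun h0 ↦ hw 0 (by simpa using h0), fun h0 ↦ hw (-1) ?_, ?_, ?_⟩
  · rw [neg_one_smul]
    exact (neg_eq_of_add_eq_zero_right h0).symm
  · have hH := card_mul_card_filter_trace_eq_zero (F := F) hv
    have hHH := card_mul_card_filter_trace_eq_zero_and hv hw
    have hsum : #{x ∈ D | Algebra.trace F E (v * x) = 0} +
        #{x : E | Algebra.trace F E (v * x) = 0 ∧ Algebra.trace F E (w * x) = 0} =
        #{x : E | Algebra.trace F E (v * x) = 0} := by
      rw [← card_filter_add_card_filter_not (s := {x : E | Algebra.trace F E (v * x) = 0})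
        (fun x ↦ x ∈ D), filter_filter, filter_filter]
      congr 2
      · ext x
        simp [and_comm]
      · ext x
        simp only [mem_filter, mem_univ, true_and, and_congr_right_iff]
        intro hvx
        by_cases hx : x ∈ D
        · simp [hx, hmem hx hvx, hu]
        · simpa [hx] using h x hvx
    rw [hF] at hH hHH
    omega
  · rw [card_filter, card_filter, card_filter, card_eq_sum_ones D, ← sum_add_distrib,
      ← sum_add_distrib]
    refine sum_congr rfl fun x hx ↦ ?_
    rw [add_mul, map_add]
    have huu := hone u hu
    subst huu
    by_cases h1 : Algebra.trace F E (v * x) = 0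
    · simp [h1, hmem hx h1]
    · by_cases h2 : Algebra.trace F E (w * x) = 0
      · simp [h1, h2]
      · have h3 : (1 : F) + 1 = 0 := by
          by_contra h3
          simpa using hone _ h3
        simp [hone _ h1, hone _ h2, h3]

/-- If all zeros of `f_D + Tr(v ·)` lie on the hyperplane `w^⊥`, then the hyperplane sections of
`D` are determined. -/
theorem card_of_add_trace_eq_zero_imp
    (hinv : ∀ l : F, l ≠ 0 → ∀ x ∈ D, algebraMap F E l * x ∈ D) {v w : E} (hw : w ≠ 0)
    (h : ∀ x, (if x ∈ D then (1 : F) else 0) + Algebra.trace F E (v * x) = 0 →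
      Algebra.trace F E (w * x) = 0) :
    #{x ∈ D | Algebra.trace F E (w * x) = 0} = #D ∨
      #D + #{x : E | Algebra.trace F E (w * x) = 0} =
        Fintype.card E + #{x ∈ D | Algebra.trace F E (w * x) = 0} ∨
      v ≠ 0 ∧ v + w ≠ 0 ∧
      Fintype.card F * (Fintype.card F * #D) + Fintype.card E =
        Fintype.card F * Fintype.card E +
          Fintype.card F * (Fintype.card F * #{x ∈ D | Algebra.trace F E (w * x) = 0}) ∧
      #{x ∈ D | Algebra.trace F E (v * x) = 0} + #{x ∈ D | Algebra.trace F E (w * x) = 0} =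
        #{x ∈ D | Algebra.trace F E ((v + w) * x) = 0} + #D := by
  have hD (x : E) (hx : Algebra.trace F E (w * x) ≠ 0) :
      x ∈ D ↔ Algebra.trace F E (v * x) = 0 := by
    refine ⟨fun hxD ↦ ?_, fun hvx ↦ ?_⟩
    · by_contra hc
      set c := Algebra.trace F E (v * x) with hc'
      have hl : -c⁻¹ ≠ 0 := neg_ne_zero.mpr (inv_ne_zero hc)
      have := h (algebraMap F E (-c⁻¹) * x) (by
        rw [if_pos (hinv _ hl x hxD), ← Algebra.smul_def, mul_smul_comm, map_smul, ← hc',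
          smul_eq_mul]
        field_simp
        ring)
      rw [← Algebra.smul_def, mul_smul_comm, map_smul, smul_eq_mul] at this
      exact hx ((mul_eq_zero.mp this).resolve_left hl)
    · by_contra hxD
      exact hx (h x (by rw [if_neg hxD, hvx, add_zero]))
  have hcardD : #D = ∑ x : E, if x ∈ D then 1 else 0 := by simp
  have hfilterD (p : E → Prop) [DecidablePred p] :
      #{x ∈ D | p x} = ∑ x : E, if x ∈ D ∧ p x then 1 else 0 := by
    rw [← card_filter]
    congr 1
    ext x
    simp
  by_cases hdep : ∃ a : F, v = a • w
  · obtain ⟨a, rfl⟩ := hdep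
    rcases eq_or_ne a 0 with rfl | ha
    · refine .inr (.inl ?_)
      rw [hfilterD, hcardD, card_filter, ← card_univ, card_eq_sum_ones, ← sum_add_distrib,
        ← sum_add_distrib]
      refine sum_congr rfl fun x _ ↦ ?_
      by_cases hx : Algebra.trace F E (w * x) = 0
      · simp [hx, add_comm]
      · simp [hx, (hD x hx).mpr (by simp)]
    · left
      congr 1
      refine filter_true_of_mem fun x hxD ↦ ?_
      by_contra hx
      have := (hD x hx).mp hxD
      rw [smul_mul_assoc, map_smul, smul_eq_mul] at this
      exact hx ((mul_eq_zero.mp this).resolve_left ha)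
  · push Not at hdep
    have hv : v ≠ 0 := fun h0 ↦ hdep 0 (by simpa using h0)
    refine .inr (.inr ⟨hv, fun h0 ↦ hdep (-1) ?_, ?_, ?_⟩)
    · rw [neg_one_smul]
      exact eq_neg_of_add_eq_zero_left h0
    · have hH := card_mul_card_filter_trace_eq_zero (F := F) hv
      have hHH := card_mul_card_filter_trace_eq_zero_and hw hdep
      have hsum : #D +
          #{x : E | Algebra.trace F E (w * x) = 0 ∧ Algebra.trace F E (v * x) = 0} =
          #{x : E | Algebra.trace F E (v * x) = 0} +
            #{x ∈ D | Algebra.trace F E (w * x) = 0} := by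
        rw [hfilterD, hcardD, card_filter, card_filter, ← sum_add_distrib, ← sum_add_distrib]
        refine sum_congr rfl fun x _ ↦ ?_
        by_cases hx : Algebra.trace F E (w * x) = 0
        · simp [hx, add_comm]
        · simp [hx, hD x hx]
      linear_combination (Fintype.card F) * (Fintype.card F) * hsum - hHH + Fintype.card F * hH
    · rw [card_filter, card_filter, card_filter, card_eq_sum_ones D, ← sum_add_distrib,
        ← sum_add_distrib]
      refine sum_congr rfl fun x hx ↦ ?_
      rw [add_mul, map_add]
      by_cases hwx : Algebra.trace F E (w * x) = 0
      · simp [hwx]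
      · simp [hwx, (hD x hwx).mp hx]

end HyperplaneSections

theorem restricted_eigenvalue_contradiction_of_two {k Q θ1 θ2 t t₁ t₂ : ℝ} (hθ1 : 0 < θ1) (hθ2 : θ2 < 0)
    (h3 : k < Q + 2 * θ2 - (2 - 1) * θ1 ∨
      k > max (2 * max |θ1| |θ2| + θ1) (2 * max |θ1| |θ2| - (2 - 1) * θ2) ∨
      Q / 2 + θ2 - θ1 > max |θ1| |θ2|)
    (ht : t = θ1 ∨ t = θ2) (ht₁ : t₁ = θ1 ∨ t₁ = θ2) (ht₂ : t₂ = θ1 ∨ t₂ = θ2)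
    (hk : k + t = Q / 2) (hs : t₁ + t₂ = -(Q / 2)) (hQ : 0 < Q) : False := by
  have hm : -θ2 ≤ max |θ1| |θ2| := (neg_le_abs θ2).trans (le_max_right _ _)
  have hle : 2 * θ2 ≤ -(Q / 2) := by
    rcases ht₁ with rfl | rfl <;> rcases ht₂ with rfl | rfl <;> linarith
  rcases h3 with h | h | h
  · rcases ht with rfl | rfl <;> linarith
  · obtain ⟨ha, hb⟩ := max_lt_iff.mp h
    rcases ht with rfl | rfl <;> linarith
  · linarith

theorem restricted_eigenvalue_contradiction {q k Q θ1 θ2 t t₁ t₂ : ℝ} (hq : 2 ≤ q) (hθ1 : 0 < θ1) (hθ2 : θ2 < 0)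
    (hQ : 0 < Q) (hk : θ1 < k)
    (h3 : k < Q + q * θ2 - (q - 1) * θ1 ∨
      k > max (q * max |θ1| |θ2| + θ1) (q * max |θ1| |θ2| - (q - 1) * θ2) ∨
      Q / q + θ2 - θ1 > max |θ1| |θ2|)
    (ht : t = θ1 ∨ t = θ2) (ht₁ : t₁ = θ1 ∨ t₁ = θ2) (ht₂ : t₂ = θ1 ∨ t₂ = θ2)
    (hkt : k - t = Q / q) (htt : t₁ - t₂ = Q / q) : False := by
  have hr : 0 < Q / q := by positivity
  have hQr : Q = q * (Q / q) := by field_simp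
  set r := Q / q
  set θ0 := max |θ1| |θ2|
  have hm1 : θ1 ≤ θ0 := (le_abs_self θ1).trans (le_max_left _ _)
  have hm2 : -θ2 ≤ θ0 := (neg_le_abs θ2).trans (le_max_right _ _)
  have hθ : θ1 - θ2 = r := by
    rcases ht₁ with rfl | rfl <;> rcases ht₂ with rfl | rfl <;> linarith
  rcases h3 with h | h | h
  · rw [hQr, ← hθ] at h
    linarith
  · obtain ⟨ha, hb⟩ := max_lt_iff.mp h
    have hq0 : r ≤ q * θ0 := by nlinarith
    rcases ht with rfl | rfl
    · linarith
    · nlinarith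
  · linarith

/-- Let `D ⊆ F_{q^m}^*` be an `F_q^*`-invariant partial difference set with
parameters `(q^m, k, λ, μ)` and restricted eigenvalues `θ1 > 0 > θ2`, with
`θ0 = max(|θ1|,|θ2|)`.  If (1) `k − θ2 ≠ q^m`, (2) `k > θ1` and
`k > −(q−1)θ2`, and at least one of (3a) `k < q^m + qθ2 − (q−1)θ1`,
(3b) `k > max(qθ0 + θ1, qθ0 − (q−1)θ2)`, (3c) `q^{m−1} + θ2 − θ1 > θ0` holds,
then `C(M_D)` is a minimal linear code. -/
theorem minimal_of_pds {p e m q : ℕ} [Fact p.Prime] (he : 0 < e) (hm : 0 < m)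
    (hq : q = p ^ e) {F E : Type*} [Field F] [Field E] [Fintype F] [Fintype E]
    [DecidableEq E] [Algebra F E] [CharP E p]
    (hF : Fintype.card F = q) (hE : Fintype.card E = q ^ m)
    (D : Finset E) (hD0 : ∀ x ∈ D, x ≠ 0) (hDneg : ∀ d ∈ D, -d ∈ D)
    (hinv : ∀ l : F, l ≠ 0 → ∀ x ∈ D, algebraMap F E l * x ∈ D)
    (lam mu : ℕ)
    (hpds : ∀ g : E, g ≠ 0 →
      ((D ×ˢ D).filter (fun pr => pr.1 - pr.2 = g)).card = if g ∈ D then lam else mu)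
    (θ1 θ2 : ℝ) (hθ1 : 0 < θ1) (hθ2 : θ2 < 0)
    (heig : ∀ a : E, a ≠ 0 →
      (∑ x ∈ D, canonAddChar p E (a * x)) = (θ1 : ℂ) ∨
        (∑ x ∈ D, canonAddChar p E (a * x)) = (θ2 : ℂ))
    (h1 : (D.card : ℝ) - θ2 ≠ (q : ℝ) ^ m)
    (h2 : (D.card : ℝ) > θ1 ∧ (D.card : ℝ) > -(((q : ℝ) - 1) * θ2))
    (h3 : (D.card : ℝ) < (q : ℝ) ^ m + q * θ2 - ((q : ℝ) - 1) * θ1 ∨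
      (D.card : ℝ) > max (q * max |θ1| |θ2| + θ1) (q * max |θ1| |θ2| - ((q : ℝ) - 1) * θ2) ∨
      (q : ℝ) ^ (m - 1) + θ2 - θ1 > max |θ1| |θ2|) :
    ∀ w : F × E, codewordMD F E D w ≠ 0 → ∀ w' : F × E,
      Function.support (codewordMD F E D w') ⊆ Function.support (codewordMD F E D w) →
        ∃ a : F, codewordMD F E D w' = a • codewordMD F E D w := by
  classical
  intro w hw w' hsupp
  have hq2 : (2 : ℝ) ≤ q := by exact_mod_cast hF ▸ Fintype.one_lt_card (α := F)
  have hQr : (Fintype.card E : ℝ) = (q : ℝ) ^ m := by rw [hE]; push_cast; rfl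
  have hQpos : 0 < (q : ℝ) ^ m := by positivity
  have hQdiv : (q : ℝ) ^ (m - 1) = (q : ℝ) ^ m / q := by
    rw [eq_div_iff (by positivity), ← pow_succ, Nat.sub_add_cancel hm]
  rw [hQdiv] at h3
  obtain ⟨hk1, hk2⟩ := h2
  have hk0 : (0 : ℝ) < D.card := hθ1.trans hk1
  have hsec (v : E) (hv : v ≠ 0) : ∃ t : ℝ, (t = θ1 ∨ t = θ2) ∧
      (q : ℝ) * (D.filter fun x ↦ Algebra.trace F E (v * x) = 0).card =
        D.card + ((q : ℝ) - 1) * t := by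
    rw [← hF]
    rcases heig v hv with h | h
    · exact ⟨θ1, .inl rfl, card_mul_card_filter_trace_of_sum_canonAddChar hinv h⟩
    · exact ⟨θ2, .inr rfl, card_mul_card_filter_trace_of_sum_canonAddChar hinv h⟩
  have hDQ : (D.card : ℝ) ≤ (q : ℝ) ^ m := by
    rw [← hQr]; exact_mod_cast Finset.card_le_univ D
  have hzero (x : E) (hx : w.1 * (if x ∈ D then (1 : F) else 0) +
      Algebra.trace F E (w.2 * x) = 0) :
      w'.1 * (if x ∈ D then (1 : F) else 0) + Algebra.trace F E (w'.2 * x) = 0 := by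
    rcases eq_or_ne x 0 with rfl | hx0
    · have : (0 : E) ∉ D := fun h ↦ hD0 0 h rfl
      simp [this]
    · by_contra hx'
      exact hsupp (a := ⟨x, hx0⟩) hx' hx
  obtain ⟨u, v⟩ := w
  obtain ⟨u', v'⟩ := w'
  simp only at hzero
  rcases eq_or_ne u 0 with rfl | hu
  · have hv : v ≠ 0 := by
      rintro rfl
      exact hw (funext fun x ↦ by simp [codewordMD])
    rcases eq_or_ne u' 0 with rfl | hu'
    · obtain ⟨a, rfl⟩ := exists_eq_smul_of_trace_eq_zero (F := F) (v := v) (w := v')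
        fun x hx ↦ by simpa using hzero x (by simpa using hx)
      exact ⟨a, funext fun x ↦ by simp [codewordMD]⟩
    exfalso
    obtain ⟨t, ht, htq⟩ := hsec v hv
    rcases filter_eq_empty_or_card_eq_two_of_trace_eq_zero_imp hinv hu' hv
      fun x hx ↦ hzero x (by simpa using hx) with h0 | ⟨hF2, hv', hvv', hQ4, hsum⟩
    · rw [h0, Nat.cast_zero, mul_zero] at htq
      rcases ht with rfl | rfl
      · nlinarith
      · linarith
    · obtain ⟨t₁, ht₁, htq₁⟩ := hsec v' hv'
      obtain ⟨t₂, ht₂, htq₂⟩ := hsec (v + v') hvv'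
      have hq' : (q : ℝ) = 2 := by exact_mod_cast hF ▸ hF2
      have hQ4' := congrArg (Nat.cast : ℕ → ℝ) hQ4
      have hsum' := congrArg (Nat.cast : ℕ → ℝ) hsum
      push_cast at hQ4' hsum'
      rw [hQr] at hQ4'
      generalize (q : ℝ) ^ m = Q at *
      rw [hq'] at h3 htq htq₁ htq₂
      exact restricted_eigenvalue_contradiction_of_two hθ1 hθ2 h3 ht ht₁ ht₂
        (by linarith) (by linarith) hQpos
  · refine ⟨u' / u, ?_⟩
    suffices hz : v' - (u' / u) • v = 0 by
      funext x
      rw [sub_eq_zero.mp hz]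
      simp only [codewordMD, Pi.smul_apply, smul_eq_mul, smul_mul_assoc, map_smul]
      field_simp
    by_contra hz
    obtain ⟨t, ht, htq⟩ := hsec _ hz
    rcases card_of_add_trace_eq_zero_imp hinv (v := u⁻¹ • v) hz fun x hx ↦ by
      rw [smul_mul_assoc, map_smul, smul_eq_mul] at hx
      have hx0 : u * (if x ∈ D then (1 : F) else 0) + Algebra.trace F E (v * x) = 0 := by
        have := congrArg (u * ·) hx
        simpa [mul_add, hu] using this
      have := hzero x hx0
      rw [sub_mul, map_sub, smul_mul_assoc, map_smul, smul_eq_mul]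
      linear_combination (norm := (field_simp; ring)) this - (u' / u) * hx0
      with h0 | h0 | ⟨hv, hvw, hQ, hsum⟩
    · rw [h0] at htq
      have : (D.card : ℝ) = t :=
        mul_left_cancel₀ (sub_ne_zero.mpr (by linarith : (q : ℝ) ≠ 1)) (by linarith)
      rcases ht with rfl | rfl <;> linarith
    · have hH := card_mul_card_filter_trace_eq_zero (F := F) hz
      rw [hF] at hH
      have h0' := congrArg (Nat.cast : ℕ → ℝ) h0
      have hH' := congrArg (Nat.cast : ℕ → ℝ) hH
      push_cast at h0' hH'
      rw [hQr] at h0' hH'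
      have : (D.card : ℝ) - t = (q : ℝ) ^ m :=
        mul_left_cancel₀ (sub_ne_zero.mpr (by linarith : (q : ℝ) ≠ 1))
          (by linear_combination (q : ℝ) * h0' - hH' + htq)
      rcases ht with rfl | rfl
      · linarith
      · exact h1 this
    · obtain ⟨t₁, ht₁, htq₁⟩ := hsec _ hv
      obtain ⟨t₂, ht₂, htq₂⟩ := hsec _ hvw
      rw [hF] at hQ
      have hQ' := congrArg (Nat.cast : ℕ → ℝ) hQ
      have hsum' := congrArg (Nat.cast : ℕ → ℝ) hsum
      push_cast at hQ' hsum'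
      rw [hQr] at hQ'
      have hq1 : (q : ℝ) - 1 ≠ 0 := sub_ne_zero.mpr (by linarith : (q : ℝ) ≠ 1)
      have hkt : (D.card : ℝ) - t = (q : ℝ) ^ m / q := by
        rw [eq_div_iff (by positivity)]
        exact mul_left_cancel₀ hq1 (by linear_combination hQ' + q * htq)
      have htt : t₁ - t₂ = D.card - t :=
        mul_left_cancel₀ hq1 (by linear_combination q * hsum' - htq₁ - htq + htq₂)
      exact restricted_eigenvalue_contradiction hq2 hθ1 hθ2 hQpos hk1 h3 ht ht₁ ht₂ hkt
        (htt.trans hkt)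
end

section
/- Let D ⊆ F_{q^m}^* be a proper nonempty F_q^*-invariant partial difference set with parameters (q^m, k, λ, μ), and let θ1 > 0 > θ2 be real numbers such that Ψ_a(D) ∈ {θ1, θ2} for every a ∈ F_{q^m}^*, with both values attained. Assume C(M_D) is a minimal linear code. Then q^m − q^{m−1} + θ2 ≠ 0, and the set of nonzero Hamming weights occurring in C(M_D) has exactly three elements if k ∈ {q^m − q^{m−1}, q^m − q^{m−1} + θ1, q^m − q^{m−1} + θ2}, and exactly four elements otherwise. -/
/-- The canonical additive character of a field of characteristic `p`, as an `AddChar`. -/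
noncomputable def traceAddChar (p : ℕ) [Fact p.Prime] (K : Type*) [Field K] [CharP K p] :
    AddChar K ℂ :=
  letI := ZMod.algebra K p
  (ZMod.stdAddChar (N := p)).compAddMonoidHom (Algebra.trace (ZMod p) K).toAddMonoidHom

theorem canonAddChar_eq_traceAddChar (p : ℕ) [Fact p.Prime] (K : Type*) [Field K] [CharP K p]
    (x : K) : canonAddChar p K x = traceAddChar p K x := by
  let := ZMod.algebra K p
  change _ = ZMod.stdAddChar (Algebra.trace (ZMod p) K x)
  rw [ZMod.stdAddChar_apply, ZMod.toCircle_apply]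
  rfl

theorem traceAddChar_isPrimitive (p : ℕ) [Fact p.Prime] (K : Type*) [Field K] [Finite K]
    [CharP K p] : (traceAddChar p K).IsPrimitive := by
  let := ZMod.algebra K p
  apply AddChar.IsPrimitive.of_ne_one
  intro h
  have : FiniteDimensional (ZMod p) K := Module.Finite.of_finite
  obtain ⟨x, hx⟩ := Algebra.trace_surjective (ZMod p) K 1
  have h1 : traceAddChar p K x = 1 := by rw [h, AddChar.one_apply]
  change ZMod.stdAddChar (Algebra.trace (ZMod p) K x) = 1 at h1
  rw [hx, ← AddChar.map_zero_eq_one (ZMod.stdAddChar (N := p))] at h1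
  exact one_ne_zero (ZMod.injective_stdAddChar h1)

theorem traceAddChar_trace (p : ℕ) [Fact p.Prime] {F E : Type*} [Field F] [Field E] [Finite E]
    [Algebra F E] [CharP F p] [CharP E p] (x : E) :
    traceAddChar p F (Algebra.trace F E x) = traceAddChar p E x := by
  let := ZMod.algebra F p
  let := ZMod.algebra E p
  have : IsScalarTower (ZMod p) F E := IsScalarTower.of_algebraMap_eq' (Subsingleton.elim _ _)
  have : Finite F := Finite.of_injective _ (algebraMap F E).injective
  have : FiniteDimensional (ZMod p) F := Module.Finite.of_finite
  have : FiniteDimensional F E := Module.Finite.of_finite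
  change ZMod.stdAddChar (Algebra.trace (ZMod p) F (Algebra.trace F E x)) =
    ZMod.stdAddChar (Algebra.trace (ZMod p) E x)
  rw [Algebra.trace_trace]

/-- Number of nonzero values on `E` of the function defining the codeword `c(u,v)`. -/
noncomputable def weightMD (F : Type*) {E : Type*} [Field F] [Field E] [Fintype E] [DecidableEq F]
    [DecidableEq E] [Algebra F E] (D : Finset E) (w : F × E) : ℕ :=
  (Finset.univ.filter fun x : E ↦
    w.1 * (if x ∈ D then (1 : F) else 0) + Algebra.trace F E (w.2 * x) ≠ 0).card

theorem card_support_codewordMD {F E : Type*} [Field F] [Field E] [Fintype E] [DecidableEq F]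
    [DecidableEq E] [Algebra F E]
    {D : Finset E} (hD0 : ∀ x ∈ D, x ≠ 0) (w : F × E) :
    (Finset.univ.filter fun x : {x : E // x ≠ 0} ↦ codewordMD F E D w x ≠ 0).card =
      weightMD F D w := by
  refine Finset.card_bij (fun x _ ↦ (x : E)) ?_ ?_ ?_
  · intro x hx
    simpa [codewordMD] using hx
  · intro x _ y _ h
    exact Subtype.ext h
  · intro x hx
    have hx0 : x ≠ 0 := by
      rintro rfl
      have h0 : (0 : E) ∉ D := fun h ↦ hD0 0 h rfl
      simp [h0] at hx
    exact ⟨⟨x, hx0⟩, by simpa [codewordMD] using hx, rfl⟩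

theorem weightMD_of_snd_eq_zero {F E : Type*} [Field F] [Field E] [Fintype E] [DecidableEq F]
    [DecidableEq E] [Algebra F E]
    (D : Finset E) {u : F} (hu : u ≠ 0) :
    weightMD F D (u, (0 : E)) = D.card := by
  simp [weightMD, hu]

theorem sum_smul_traceAddChar {F E : Type*} [Field F] [Field E] [Algebra F E]
    (p : ℕ) [Fact p.Prime] [CharP E p] {D : Finset E}
    (hinv : ∀ l : F, l ≠ 0 → ∀ x ∈ D, algebraMap F E l * x ∈ D) {l : F} (hl : l ≠ 0) (v : E) :
    ∑ x ∈ D, traceAddChar p E (algebraMap F E l * (v * x)) =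
      ∑ x ∈ D, traceAddChar p E (v * x) := by
  have hl' : algebraMap F E l ≠ 0 := by simpa using hl
  refine Finset.sum_nbij' (fun x ↦ algebraMap F E l * x) (fun x ↦ algebraMap F E l⁻¹ * x)
    (fun x hx ↦ hinv l hl x hx) (fun x hx ↦ hinv _ (inv_ne_zero hl) x hx) ?_ ?_ ?_
  · intro x _
    simp [map_inv₀, hl']
  · intro x _
    simp [map_inv₀, hl']
  · intro x _
    ring_nf

theorem card_mul_card_zeros {F E : Type*} [Field F] [Field E] [Fintype F] [Fintype E]
    [DecidableEq F]
    [DecidableEq E] [Algebra F E]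
    (p : ℕ) [Fact p.Prime] [CharP F p] [CharP E p] {D : Finset E}
    (hinv : ∀ l : F, l ≠ 0 → ∀ x ∈ D, algebraMap F E l * x ∈ D) (u : F) {v : E} (hv : v ≠ 0) :
    (Fintype.card F : ℂ) * (Finset.univ.filter fun x : E ↦
      u * (if x ∈ D then (1 : F) else 0) + Algebra.trace F E (v * x) = 0).card =
      Fintype.card E - if u = 0 then 0 else
        Fintype.card F * ∑ x ∈ D, traceAddChar p E (v * x) := by
  set ψ := traceAddChar p F
  set S := ∑ x ∈ D, traceAddChar p E (v * x)
  have hψ : ψ.IsPrimitive := traceAddChar_isPrimitive p F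
  have key (l : F) : ∑ x : E, ψ (l * (u * (if x ∈ D then (1 : F) else 0) +
      Algebra.trace F E (v * x))) =
      (if l = 0 then (Fintype.card E : ℂ) else 0) + (ψ (l * u) - 1) * S := by
    by_cases hl : l = 0
    · simp [hl]
    have h1 (x : E) : ψ (l * (u * (if x ∈ D then (1 : F) else 0) +
        Algebra.trace F E (v * x))) = traceAddChar p E (x * (algebraMap F E l * v)) +
        if x ∈ D then (ψ (l * u) - 1) * traceAddChar p E (algebraMap F E l * (v * x)) else 0 := by
      have h2 : ψ (l * Algebra.trace F E (v * x)) =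
          traceAddChar p E (algebraMap F E l * (v * x)) := by
        rw [← Algebra.smul_def, ← traceAddChar_trace (F := F) p (l • (v * x)),
          LinearMap.map_smul, smul_eq_mul]
      have h3 : x * (algebraMap F E l * v) = algebraMap F E l * (v * x) := by ring
      rw [mul_add, AddChar.map_add_eq_mul, h2, h3]
      split_ifs
      · rw [mul_one]; ring
      · simp
    have hlv : algebraMap F E l * v ≠ 0 := mul_ne_zero (by simpa using hl) hv
    simp_rw [h1]
    rw [Finset.sum_add_distrib, AddChar.sum_mulShift _ (traceAddChar_isPrimitive p E),
      if_neg hlv, if_neg hl, ← Finset.sum_filter, ← Finset.mul_sum, Finset.filter_mem_eq_inter,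
      Finset.univ_inter, sum_smul_traceAddChar p hinv hl]
    simp [S]
  calc _ = ∑ x : E, ∑ l : F, ψ (l * (u * (if x ∈ D then (1 : F) else 0) +
        Algebra.trace F E (v * x))) := by
        simp_rw [AddChar.sum_mulShift _ hψ, Nat.cast_ite, Nat.cast_zero]
        rw [← Finset.sum_filter, Finset.sum_const, nsmul_eq_mul, mul_comm]
    _ = _ := by
      rw [Finset.sum_comm]
      simp_rw [key]
      rw [Finset.sum_add_distrib, ← Finset.sum_mul, Finset.sum_sub_distrib,
        AddChar.sum_mulShift _ hψ]
      split_ifs <;> simp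
      ring

theorem weightMD_of_snd_ne_zero {F E : Type*} [Field F] [Field E] [Fintype F] [Fintype E]
    [DecidableEq F]
    [DecidableEq E] [Algebra F E]
    (p : ℕ) [Fact p.Prime] [CharP F p] [CharP E p] {q m : ℕ}
    (hm : 0 < m) (hF : Fintype.card F = q) (hE : Fintype.card E = q ^ m) {D : Finset E}
    (hinv : ∀ l : F, l ≠ 0 → ∀ x ∈ D, algebraMap F E l * x ∈ D) (u : F) {v : E} (hv : v ≠ 0) :
    (weightMD F D (u, v) : ℂ) = (q : ℂ) ^ m - (q : ℂ) ^ (m - 1) +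
      if u = 0 then 0 else ∑ x ∈ D, canonAddChar p E (v * x) := by
  have hz := card_mul_card_zeros p hinv u hv
  have hc := Finset.card_filter_add_card_filter_not (s := (Finset.univ : Finset E)) fun x ↦
    u * (if x ∈ D then (1 : F) else 0) + Algebra.trace F E (v * x) = 0
  rw [Finset.card_univ, hE] at hc
  have hc' := congrArg (Nat.cast : ℕ → ℂ) hc
  push_cast at hc'
  have hq : (q : ℂ) ≠ 0 := by
    rw [← hF]
    exact_mod_cast Fintype.card_ne_zero
  have hqm : (q : ℂ) ^ m = q * q ^ (m - 1) := by rw [mul_pow_sub_one hm.ne']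
  rw [hE, hF] at hz
  push_cast at hz
  simp_rw [canonAddChar_eq_traceAddChar]
  change ((Finset.card (Finset.univ.filter fun x : E ↦ ¬ (u * (if x ∈ D then (1 : F) else 0) +
    Algebra.trace F E (v * x) = 0)) : ℕ) : ℂ) = _
  apply mul_left_cancel₀ hq
  split_ifs at hz ⊢
  · linear_combination q * hc' - hz - hqm
  · linear_combination q * hc' - hz - hqm

theorem weightMD_eq_zero_iff {F E : Type*} [Field F] [Field E] [Fintype E] [DecidableEq F]
    [DecidableEq E] [Algebra F E]
    (D : Finset E) (u : F) (v : E) : weightMD F D (u, v) = 0 ↔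
    ∀ x : E, u * (if x ∈ D then (1 : F) else 0) + Algebra.trace F E (v * x) = 0 := by
  simp [weightMD, Finset.filter_eq_empty_iff]

open Finset in
/-- Let `D ⊆ F_{q^m}^*` be a proper nonempty `F_q^*`-invariant partial
difference set with parameters `(q^m, k, λ, μ)` and restricted eigenvalues
`θ1 > 0 > θ2`, both attained, and assume `C(M_D)` is minimal.  Then
`q^m − q^{m−1} + θ2 ≠ 0`, and `C(M_D)` has exactly three nonzero weights if
`k ∈ {q^m − q^{m−1}, q^m − q^{m−1} + θ1, q^m − q^{m−1} + θ2}`, and exactly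
four nonzero weights otherwise. -/
theorem three_or_four_weights {p e m q : ℕ} [Fact p.Prime] (he : 0 < e) (hm : 0 < m)
    (hq : q = p ^ e) {F E : Type*} [Field F] [Field E] [Fintype F] [Fintype E]
    [DecidableEq F] [DecidableEq E] [Algebra F E] [CharP E p]
    (hF : Fintype.card F = q) (hE : Fintype.card E = q ^ m)
    (D : Finset E) (hD0 : ∀ x ∈ D, x ≠ 0) (hDne : D.Nonempty)
    (hDproper : (D : Set E) ≠ {x : E | x ≠ 0}) (hDneg : ∀ d ∈ D, -d ∈ D)
    (hinv : ∀ l : F, l ≠ 0 → ∀ x ∈ D, algebraMap F E l * x ∈ D)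
    (lam mu : ℕ)
    (hpds : ∀ g : E, g ≠ 0 →
      ((D ×ˢ D).filter (fun pr => pr.1 - pr.2 = g)).card = if g ∈ D then lam else mu)
    (θ1 θ2 : ℝ) (hθ1 : 0 < θ1) (hθ2 : θ2 < 0)
    (heig : ∀ a : E, a ≠ 0 →
      (∑ x ∈ D, canonAddChar p E (a * x)) = (θ1 : ℂ) ∨
        (∑ x ∈ D, canonAddChar p E (a * x)) = (θ2 : ℂ))
    (hatt1 : ∃ a : E, a ≠ 0 ∧ (∑ x ∈ D, canonAddChar p E (a * x)) = (θ1 : ℂ))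
    (hatt2 : ∃ a : E, a ≠ 0 ∧ (∑ x ∈ D, canonAddChar p E (a * x)) = (θ2 : ℂ))
    (hmin : ∀ w : F × E, codewordMD F E D w ≠ 0 → ∀ w' : F × E,
      Function.support (codewordMD F E D w') ⊆ Function.support (codewordMD F E D w) →
        ∃ a : F, codewordMD F E D w' = a • codewordMD F E D w) :
    ((q : ℝ) ^ m - (q : ℝ) ^ (m - 1) + θ2 ≠ 0) ∧
    (((D.card : ℝ) = (q : ℝ) ^ m - (q : ℝ) ^ (m - 1) ∨
        (D.card : ℝ) = (q : ℝ) ^ m - (q : ℝ) ^ (m - 1) + θ1 ∨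
        (D.card : ℝ) = (q : ℝ) ^ m - (q : ℝ) ^ (m - 1) + θ2) →
      {w : ℕ | w ≠ 0 ∧ ∃ uv : F × E,
        (univ.filter (fun x : {x : E // x ≠ 0} =>
          codewordMD F E D uv x ≠ 0)).card = w}.ncard = 3) ∧
    (¬ ((D.card : ℝ) = (q : ℝ) ^ m - (q : ℝ) ^ (m - 1) ∨
        (D.card : ℝ) = (q : ℝ) ^ m - (q : ℝ) ^ (m - 1) + θ1 ∨
        (D.card : ℝ) = (q : ℝ) ^ m - (q : ℝ) ^ (m - 1) + θ2) →
      {w : ℕ | w ≠ 0 ∧ ∃ uv : F × E,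
        (univ.filter (fun x : {x : E // x ≠ 0} =>
          codewordMD F E D uv x ≠ 0)).card = w}.ncard = 4) := by
  have : CharP F p := (algebraMap F E).charP (algebraMap F E).injective p
  have hF2 : 1 < q := hF ▸ Fintype.one_lt_card
  have hw0 : (0 : ℝ) < (q : ℝ) ^ m - (q : ℝ) ^ (m - 1) :=
    sub_pos.2 (pow_lt_pow_right₀ (by exact_mod_cast hF2) (by omega))
  have hk : 0 < D.card := hDne.card_pos
  have weight_zero (v : E) (hv : v ≠ 0) :
      (weightMD F D ((0 : F), v) : ℝ) = (q : ℝ) ^ m - (q : ℝ) ^ (m - 1) := by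
    have h := weightMD_of_snd_ne_zero p hm hF hE hinv (0 : F) hv
    rw [if_pos rfl, add_zero] at h
    exact_mod_cast h
  have weight_eq (θ : ℝ) (u : F) (hu : u ≠ 0) (v : E) (hv : v ≠ 0)
      (hθ : ∑ x ∈ D, canonAddChar p E (v * x) = (θ : ℂ)) :
      (weightMD F D (u, v) : ℝ) = (q : ℝ) ^ m - (q : ℝ) ^ (m - 1) + θ := by
    have h := weightMD_of_snd_ne_zero p hm hF hE hinv u hv
    rw [if_neg hu, hθ] at h
    exact_mod_cast h
  obtain ⟨a, ha, haθ⟩ := hatt1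
  obtain ⟨b, hb, hbθ⟩ := hatt2
  have hN0 := weight_zero a ha
  have hN1 := weight_eq θ1 1 one_ne_zero a ha haθ
  have hN2 := weight_eq θ2 1 one_ne_zero b hb hbθ
  have hne : (q : ℝ) ^ m - (q : ℝ) ^ (m - 1) + θ2 ≠ 0 := by
    intro h0
    rw [h0, Nat.cast_eq_zero, weightMD_eq_zero_iff] at hN2
    have hab : weightMD F D ((1 : F), a) = weightMD F D ((0 : F), a - b) := by
      unfold weightMD
      congr 1
      ext x
      have hx := hN2 x
      simp only [mem_filter, mem_univ, true_and, sub_mul, map_sub]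
      rw [zero_mul, zero_add, eq_neg_of_add_eq_zero_left hx, neg_add_eq_sub]
    rw [hab] at hN1
    rcases eq_or_ne (a - b) 0 with h | h
    · rw [h] at hN1
      simp [weightMD] at hN1
      linarith
    · rw [weight_zero _ h] at hN1
      linarith
  set N0 := weightMD F D ((0 : F), a)
  set N1 := weightMD F D ((1 : F), a)
  set N2 := weightMD F D ((1 : F), b)
  have hset : {w : ℕ | w ≠ 0 ∧ ∃ uv : F × E, (univ.filter (fun x : {x : E // x ≠ 0} =>
      codewordMD F E D uv x ≠ 0)).card = w} = ↑({N0, N1, N2, D.card} : Finset ℕ) := by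
    simp_rw [card_support_codewordMD hD0]
    ext w
    simp only [Set.mem_ofPred_eq, coe_insert, coe_singleton, Set.mem_insert_iff,
      Set.mem_singleton_iff]
    constructor
    · rintro ⟨hw, ⟨u, v⟩, rfl⟩
      rcases eq_or_ne v 0 with rfl | hv
      · rcases eq_or_ne u 0 with rfl | hu
        · simp [weightMD] at hw
        · simp [weightMD_of_snd_eq_zero D hu]
      rcases eq_or_ne u 0 with rfl | hu
      · left
        exact_mod_cast (weight_zero v hv).trans hN0.symm
      right
      rcases heig v hv with h | h
      · left
        exact_mod_cast (weight_eq θ1 u hu v hv h).trans hN1.symm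
      · right; left
        exact_mod_cast (weight_eq θ2 u hu v hv h).trans hN2.symm
    · rintro (rfl | rfl | rfl | rfl)
      · refine ⟨fun h ↦ ?_, _, rfl⟩
        rw [h, Nat.cast_zero] at hN0
        linarith
      · refine ⟨fun h ↦ ?_, _, rfl⟩
        rw [h, Nat.cast_zero] at hN1
        linarith
      · refine ⟨fun h ↦ ?_, _, rfl⟩
        rw [h, Nat.cast_zero] at hN2
        exact hne hN2.symm
      · exact ⟨hk.ne', _, weightMD_of_snd_eq_zero D (one_ne_zero (α := F))⟩
  have h01 : N0 ≠ N1 := fun h ↦ by rw [h] at hN0; linarith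
  have h02 : N0 ≠ N2 := fun h ↦ by rw [h] at hN0; linarith
  have h12 : N1 ≠ N2 := fun h ↦ by rw [h] at hN1; linarith
  rw [hset, Set.ncard_coe_finset, ← hN1, ← hN2, ← hN0]
  simp only [Nat.cast_inj]
  refine ⟨by rw [hN2]; exact hne, ?_, ?_⟩
  · rintro (h | h | h) <;> rw [h]
    · rw [show ({N0, N1, N2, N0} : Finset ℕ) = {N0, N1, N2} by grind]
      exact card_eq_three.2 ⟨_, _, _, h01, h02, h12, rfl⟩
    · rw [show ({N0, N1, N2, N1} : Finset ℕ) = {N0, N1, N2} by grind]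
      exact card_eq_three.2 ⟨_, _, _, h01, h02, h12, rfl⟩
    · rw [show ({N0, N1, N2, N2} : Finset ℕ) = {N0, N1, N2} by grind]
      exact card_eq_three.2 ⟨_, _, _, h01, h02, h12, rfl⟩
  · intro h
    push Not at h
    rw [card_insert_of_notMem, card_insert_of_notMem, card_insert_of_notMem, card_singleton] <;>
      grind
end
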